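/- arXiv:1008.3781 — 4 statements merged into one kernel-verified Lean document; each statement's English description precedes it below -/
import Mathlib

section
/- Let M be a smooth manifold equipped with the smooth pseudo-Riemannian metric on R^6 given by g = dx_1 dx_6 + dx_2 dx_5 + dx_3 dx_4 + x_1 x_2 x_3 dx_1^2; concretely, for x, u, w ∈ R^6 let g_x(u,w) = u_1 w_6 + u_6 w_1 + u_2 w_5 + u_5 w_2 + u_3 w_4 + u_4 w_3 + x_1 x_2 x_3 · u_1 w_1. Let φ_t be the linear map of R^6 given by the diagonal matrix diag(e^{−t}, e^{−2t}, e^{−3t}, e^{−5t}, e^{−6t}, e^{−7t}). Then for every t ∈ R and all x, u, w ∈ R^6 one has g_{φ_t(x)}(φ_t(u), φ_t(w)) = e^{−8t} · g_x(u,w); in other words, the linear flow φ_t acts conformally for the metric g. -/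
/-- The pseudo-Riemannian metric `g = dx₁dx₆ + dx₂dx₅ + dx₃dx₄ + x₁x₂x₃ dx₁²` on `ℝ⁶`,
as a family of symmetric bilinear forms: `g_x(u,w)`. Coordinates are 0-indexed. -/
noncomputable def gMetric (x u w : Fin 6 → ℝ) : ℝ :=
  u 0 * w 5 + u 5 * w 0 + u 1 * w 4 + u 4 * w 1 + u 2 * w 3 + u 3 * w 2
    + x 0 * x 1 * x 2 * (u 0 * w 0)

/-- The exponents of the linear flow `diag(e^{−t}, e^{−2t}, e^{−3t}, e^{−5t}, e^{−6t}, e^{−7t})`. -/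
noncomputable def flowExponent : Fin 6 → ℝ := ![1, 2, 3, 5, 6, 7]

/-- The linear flow `φ_t = diag(e^{−t}, e^{−2t}, e^{−3t}, e^{−5t}, e^{−6t}, e^{−7t})` on `ℝ⁶`. -/
noncomputable def phiFlow (t : ℝ) (x : Fin 6 → ℝ) : Fin 6 → ℝ :=
  fun i => Real.exp (-(flowExponent i) * t) * x i

/-- The linear flow `φ_t` acts conformally for the metric `g`:
`g_{φ_t(x)}(φ_t(u), φ_t(w)) = e^{−8t} · g_x(u,w)`. -/
theorem phiFlow_conformal (t : ℝ) (x u w : Fin 6 → ℝ) :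
    gMetric (phiFlow t x) (phiFlow t u) (phiFlow t w)
      = Real.exp (-(8 : ℝ) * t) * gMetric x u w := by
  have exp_eq_pow (n : ℕ) : Real.exp (-(n : ℝ) * t) = Real.exp (-t) ^ n := by
    rw [← Real.exp_nat_mul]
    ring_nf
  have h1 := exp_eq_pow 1
  have h2 := exp_eq_pow 2
  have h3 := exp_eq_pow 3
  have h5 := exp_eq_pow 5
  have h6 := exp_eq_pow 6
  have h7 := exp_eq_pow 7
  have h8 := exp_eq_pow 8
  push_cast at h1 h2 h3 h5 h6 h7 h8
  have f0 : flowExponent 0 = 1 := rfl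
  have f1 : flowExponent 1 = 2 := rfl
  have f2 : flowExponent 2 = 3 := rfl
  have f3 : flowExponent 3 = 5 := rfl
  have f4 : flowExponent 4 = 6 := rfl
  have f5 : flowExponent 5 = 7 := rfl
  simp only [gMetric, phiFlow, f0, f1, f2, f3, f4, f5, h1, h2, h3, h5, h6, h7, h8]
  ring
end

section
/- Let v ∈ R^n, x ∈ R^n, u, t ∈ R, and set D = 1 + tu⟨x,v⟩ + q(v) t² u² q(x)/4. Then T_t(v)(ṽ(ux)) = D·e_0 + (ux + (t u² q(x)/2) v) − (u² q(x)/2) e_{n+1}; moreover q(ux + (t u² q(x)/2) v) = u² q(x) · D, so that whenever D ≠ 0, setting x(u,t) = D^{−1}(ux + (t u² q(x)/2) v), one has T_t(v)(ṽ(ux)) = D · ṽ(x(u,t)). (In the Einstein universe this is the formula for the orbit of the point j^o(ux) under the translation flow T_t(v).) -/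
/-- The quadratic form `q` of signature `(p,q)` on `ℝ^n`, `n = p + q`. -/
noncomputable def qpq (p q : ℕ) (x : Fin (p + q) → ℝ) : ℝ :=
  2 * ∑ i : Fin p, x ⟨i, by omega⟩ * x ⟨p + q - 1 - i, by omega⟩
    + ∑ i : Fin (q - p), x ⟨p + i, by omega⟩ ^ 2

/-- The polarization `⟨·,·⟩` of `q`. -/
noncomputable def bpq (p q : ℕ) (x y : Fin (p + q) → ℝ) : ℝ :=
  ∑ i : Fin p,
      (x ⟨i, by omega⟩ * y ⟨p + q - 1 - i, by omega⟩ +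
        x ⟨p + q - 1 - i, by omega⟩ * y ⟨i, by omega⟩)
    + ∑ i : Fin (q - p), x ⟨p + i, by omega⟩ * y ⟨p + i, by omega⟩

/-- The basis vector `e₀` of `ℝ^{n+2}`. -/
noncomputable def E0 (p q : ℕ) : Fin (p + q + 2) → ℝ :=
  fun j => if (j : ℕ) = 0 then 1 else 0

/-- The basis vector `e_{n+1}` of `ℝ^{n+2}`. -/
noncomputable def Elast (p q : ℕ) : Fin (p + q + 2) → ℝ :=
  fun j => if (j : ℕ) = p + q + 1 then 1 else 0

/-- The embedding of `ℝ^n` into the middle coordinates `1,…,n` of `ℝ^{n+2}`. -/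
noncomputable def emb (p q : ℕ) (z : Fin (p + q) → ℝ) : Fin (p + q + 2) → ℝ :=
  fun j =>
    if h0 : (j : ℕ) = 0 then 0
    else if h1 : (j : ℕ) = p + q + 1 then 0
    else z ⟨(j : ℕ) - 1, by omega⟩

/-- The lift `ṽ(z) = e₀ + z − (q(z)/2)e_{n+1}` of the chart-at-infinity point `j^o(z)`. -/
noncomputable def vtil (p q : ℕ) (z : Fin (p + q) → ℝ) : Fin (p + q + 2) → ℝ :=
  E0 p q + emb p q z - (qpq p q z / 2) • Elast p q

/-- The linear map `T_t(v)` of `ℝ^{n+2}`. -/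
noncomputable def Ttv (p q : ℕ) (v : Fin (p + q) → ℝ) (t : ℝ)
    (y : Fin (p + q + 2) → ℝ) : Fin (p + q + 2) → ℝ :=
  fun j =>
    if h0 : (j : ℕ) = 0 then
      y ⟨0, by omega⟩ + t * bpq p q v (fun i => y ⟨(i : ℕ) + 1, by omega⟩)
        - qpq p q v * t ^ 2 / 2 * y ⟨p + q + 1, by omega⟩
    else if h1 : (j : ℕ) = p + q + 1 then y j
    else y j - t * y ⟨p + q + 1, by omega⟩ * v ⟨(j : ℕ) - 1, by omega⟩

/-- The denominator `D = 1 + tu⟨x,v⟩ + q(v)t²u²q(x)/4`. -/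
noncomputable def Dcoef (p q : ℕ) (v x : Fin (p + q) → ℝ) (u t : ℝ) : ℝ :=
  1 + t * u * bpq p q x v + qpq p q v * t ^ 2 * u ^ 2 * qpq p q x / 4

/-- The polarization is symmetric. -/
theorem bpq_comm (p q : ℕ) (x y : Fin (p + q) → ℝ) : bpq p q x y = bpq p q y x := by
  unfold bpq
  congr 1 <;> exact Finset.sum_congr rfl fun i _ => by ring

theorem bpq_smul_right (p q : ℕ) (x y : Fin (p + q) → ℝ) (a : ℝ) :
    bpq p q x (a • y) = a * bpq p q x y := by
  simp only [bpq, Pi.smul_apply, smul_eq_mul, mul_add, Finset.mul_sum]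
  congr 1 <;> exact Finset.sum_congr rfl fun i _ => by ring

theorem qpq_smul_add_smul (p q : ℕ) (x y : Fin (p + q) → ℝ) (a b : ℝ) :
    qpq p q (a • x + b • y) =
      a ^ 2 * qpq p q x + 2 * a * b * bpq p q x y + b ^ 2 * qpq p q y := by
  have regroup (A B C D E F : ℝ) : A + B + (C + D) + (E + F) = (A + C + E) + (B + D + F) := by
    ring
  simp only [qpq, bpq, Pi.add_apply, Pi.smul_apply, smul_eq_mul, mul_add _ (Finset.sum _ _),
    Finset.mul_sum]
  rw [regroup, ← Finset.sum_add_distrib, ← Finset.sum_add_distrib, ← Finset.sum_add_distrib,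
    ← Finset.sum_add_distrib]
  congr 1 <;> exact Finset.sum_congr rfl fun i _ => by ring

theorem qpq_smul (p q : ℕ) (x : Fin (p + q) → ℝ) (a : ℝ) :
    qpq p q (a • x) = a ^ 2 * qpq p q x := by
  simpa using qpq_smul_add_smul p q x x a 0

theorem emb_smul (p q : ℕ) (z : Fin (p + q) → ℝ) (a : ℝ) :
    emb p q (a • z) = a • emb p q z := by
  funext j
  simp only [emb, Pi.smul_apply, smul_eq_mul]
  split_ifs <;> simp

theorem vtil_zero_coord (p q : ℕ) (z : Fin (p + q) → ℝ) :
    vtil p q z ⟨0, by omega⟩ = 1 := by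
  simp [vtil, E0, emb, Elast]

theorem vtil_last_coord (p q : ℕ) (z : Fin (p + q) → ℝ) :
    vtil p q z ⟨p + q + 1, by omega⟩ = -(qpq p q z / 2) := by
  simp [vtil, E0, emb, Elast]

theorem vtil_middle_coords (p q : ℕ) (z : Fin (p + q) → ℝ) :
    (fun i : Fin (p + q) => vtil p q z ⟨(i : ℕ) + 1, by omega⟩) = z := by
  funext i
  have hi : (i : ℕ) ≠ p + q := i.isLt.ne
  simp [vtil, E0, emb, Elast, hi]

/-- The translation `T_t(v)` applied to the lift of `z`. -/
theorem Ttv_vtil (p q : ℕ) (v z : Fin (p + q) → ℝ) (t : ℝ) :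
    Ttv p q v t (vtil p q z) =
      (1 + t * bpq p q v z + qpq p q v * t ^ 2 * qpq p q z / 4) • E0 p q
        + emb p q (z + (t * qpq p q z / 2) • v) - (qpq p q z / 2) • Elast p q := by
  funext j
  simp only [Ttv, vtil_zero_coord, vtil_last_coord, vtil_middle_coords]
  split_ifs with h0 h1
  · simp [E0, emb, Elast, h0]
    ring
  · simp [vtil, E0, emb, Elast, h1]
  · simp [vtil, E0, emb, Elast, h0, h1, -mul_eq_mul_right_iff]
    ring

/-- Formula for the orbit of `j^o(ux)` under the translation flow `T_t(v)`:
`T_t(v)(ṽ(ux)) = D·e₀ + (ux + (tu²q(x)/2)v) − (u²q(x)/2)e_{n+1}`, the middle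
vector has `q`-norm `u²q(x)·D`, and whenever `D ≠ 0` this equals `D·ṽ(x(u,t))`. -/
theorem Ttv_orbit_formula (p q : ℕ) (hp : 1 ≤ p) (hpq : p ≤ q)
    (v x : Fin (p + q) → ℝ) (u t : ℝ) :
    Ttv p q v t (vtil p q (u • x)) =
        Dcoef p q v x u t • E0 p q
          + emb p q (u • x + (t * u ^ 2 * qpq p q x / 2) • v)
          - (u ^ 2 * qpq p q x / 2) • Elast p q
    ∧ qpq p q (u • x + (t * u ^ 2 * qpq p q x / 2) • v)
        = u ^ 2 * qpq p q x * Dcoef p q v x u t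
    ∧ (Dcoef p q v x u t ≠ 0 →
        Ttv p q v t (vtil p q (u • x)) =
          Dcoef p q v x u t •
            vtil p q ((Dcoef p q v x u t)⁻¹ •
              (u • x + (t * u ^ 2 * qpq p q x / 2) • v))) := by
  have key : Ttv p q v t (vtil p q (u • x)) =
      Dcoef p q v x u t • E0 p q
        + emb p q (u • x + (t * u ^ 2 * qpq p q x / 2) • v)
        - (u ^ 2 * qpq p q x / 2) • Elast p q := by
    rw [Ttv_vtil, qpq_smul, bpq_smul_right, bpq_comm p q v x, Dcoef]
    congr 3 <;> ring_nf
  have norm_eq : qpq p q (u • x + (t * u ^ 2 * qpq p q x / 2) • v)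
      = u ^ 2 * qpq p q x * Dcoef p q v x u t := by
    rw [qpq_smul_add_smul, Dcoef]
    ring
  refine ⟨key, norm_eq, fun hD => ?_⟩
  rw [key, vtil, qpq_smul, norm_eq, emb_smul, smul_sub, smul_add, smul_inv_smul₀ hD, smul_smul]
  congr 2
  field_simp
end

section
/- Let ε ∈ {1, −1} and v = (e_1 + ε e_n)/√2 ∈ R^{p,q}. Let x ∈ R^n with ε·q(x) > 0, let t ∈ R with ε t · b(x,v) ≥ 0, and let u ∈ [0,1]. Set c = u t · b(x,v) + t² u² q(x)/4. Then ε c ≥ 0; in particular D := 1 + tu⟨x,v⟩ + ε t² u² q(x)/4 satisfies D = 1 + εc ≥ 1; and the vector x(u,t) := D^{−1}(ux + (t u² q(x)/2) v) satisfies ‖x(u,t)‖ ≤ u‖x‖. (This is the key estimate showing that the translation flow of type space or time maps the geodesic segment [o, j^o(x)] into the ball B(o, ‖x‖) for the relevant sign of t.) -/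
/-- The Euclidean inner product `b(x,y) = x₁y₁ + ⋯ + x_ny_n` on `ℝ^n`. -/
noncomputable def bEucl (p q : ℕ) (x y : Fin (p + q) → ℝ) : ℝ :=
  ∑ i, x i * y i

/-- The Euclidean norm on `ℝ^n`. -/
noncomputable def eNorm (p q : ℕ) (x : Fin (p + q) → ℝ) : ℝ :=
  Real.sqrt (∑ i, x i ^ 2)

/-- The `k`-th standard basis vector of `ℝ^n` (0-indexed). -/
noncomputable def stdb (p q : ℕ) (k : ℕ) : Fin (p + q) → ℝ :=
  fun j => if (j : ℕ) = k then 1 else 0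

/-- A sum over `Fin (p + q)` with `p ≤ q`, split into `p` pairs of mirrored indices and the
`q - p` indices in the middle. -/
theorem sum_fin_add_eq_mirror_pairs (p q : ℕ) (hpq : p ≤ q) (f : Fin (p + q) → ℝ) :
    ∑ i, f i = ∑ i : Fin p, (f ⟨i, by omega⟩ + f ⟨p + q - 1 - i, by omega⟩)
      + ∑ i : Fin (q - p), f ⟨p + i, by omega⟩ := by
  obtain ⟨g, hg⟩ : ∃ g : ℕ → ℝ, ∀ k (h : k < p + q), f ⟨k, h⟩ = g k :=
    ⟨fun k => if h : k < p + q then f ⟨k, h⟩ else 0, fun k h => by simp [h]⟩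
  have hf : ∑ i, f i = ∑ i : Fin (p + q), g i := Finset.sum_congr rfl fun i _ => hg i i.2
  obtain ⟨d, rfl⟩ := Nat.exists_eq_add_of_le hpq
  have hrefl : ∑ i ∈ Finset.range p, g (p + (p + d) - 1 - i)
      = ∑ i ∈ Finset.range p, g (p + d + i) := by
    rw [← Finset.sum_range_reflect]
    refine Finset.sum_congr rfl fun i hi => ?_
    rw [Finset.mem_range] at hi
    congr 1
    omega
  rw [hf]
  simp only [hg]
  rw [Fin.sum_univ_eq_sum_range g,
    Fin.sum_univ_eq_sum_range (fun i => g i + g (p + (p + d) - 1 - i)),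
    Fin.sum_univ_eq_sum_range (fun i => g (p + i)), Finset.sum_add_distrib, hrefl,
    show p + (p + d) = p + d + p by omega, Finset.sum_range_add, Finset.sum_range_add,
    Nat.add_sub_cancel_left]
  ring

/-- The quadratic form is bounded in absolute value by the squared Euclidean norm. -/
theorem abs_qpq_le (p q : ℕ) (hpq : p ≤ q) (x : Fin (p + q) → ℝ) :
    |qpq p q x| ≤ ∑ i, x i ^ 2 := by
  have hmid : 0 ≤ ∑ i : Fin (q - p), x ⟨p + i, by omega⟩ ^ 2 :=
    Finset.sum_nonneg fun i _ => sq_nonneg _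
  rw [sum_fin_add_eq_mirror_pairs p q hpq fun i => x i ^ 2, qpq, Finset.mul_sum, abs_le, neg_add,
    ← Finset.sum_neg_distrib]
  constructor
  · refine add_le_add (Finset.sum_le_sum fun i _ => ?_) (by linarith)
    nlinarith [sq_nonneg (x ⟨i, by omega⟩ + x ⟨p + q - 1 - i, by omega⟩)]
  · refine add_le_add (Finset.sum_le_sum fun i _ => ?_) le_rfl
    nlinarith [sq_nonneg (x ⟨i, by omega⟩ - x ⟨p + q - 1 - i, by omega⟩)]

/-- Pairing with `e₁ + ε e_n` under the form `⟨·,·⟩` is `ε` times the Euclidean pairing. -/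
theorem bpq_eq_mul_bEucl (p q : ℕ) (hp : 1 ≤ p) (hpq : p ≤ q) (ε a : ℝ) (hε : ε * ε = 1)
    (x : Fin (p + q) → ℝ) :
    bpq p q x (a • (stdb p q 0 + ε • stdb p q (p + q - 1)))
      = ε * bEucl p q x (a • (stdb p q 0 + ε • stdb p q (p + q - 1))) := by
  rw [bEucl, sum_fin_add_eq_mirror_pairs p q hpq, bpq, mul_add, Finset.mul_sum, Finset.mul_sum]
  congr 1
  · refine Finset.sum_congr rfl fun i _ => ?_
    have h1 : (p + q - 1 - (i : ℕ) = 0) ↔ False := by simp only [iff_false]; omega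
    have h2 : ((i : ℕ) = p + q - 1) ↔ False := by simp only [iff_false]; omega
    have h3 : (p + q - 1 - (i : ℕ) = p + q - 1) ↔ (i : ℕ) = 0 := by omega
    simp only [Pi.smul_apply, Pi.add_apply, stdb, smul_eq_mul, h1, h2, h3, if_false]
    split_ifs
    · linear_combination (-(a * x ⟨p + q - 1 - i, by omega⟩)) * hε
    · ring
  · refine Finset.sum_congr rfl fun i _ => ?_
    have h1 : (p + (i : ℕ) = 0) ↔ False := by simp only [iff_false]; omega
    have h2 : (p + (i : ℕ) = p + q - 1) ↔ False := by simp only [iff_false]; omega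
    simp only [Pi.smul_apply, Pi.add_apply, stdb, smul_eq_mul, h1, h2, if_false, mul_zero, add_zero]

/-- The vector `(e₁ + ε e_n)/√2` is a Euclidean unit vector. -/
theorem sum_sq_unit_vector (p q : ℕ) (hn : 2 ≤ p + q) (ε : ℝ) (hε : ε * ε = 1) :
    ∑ i, ((Real.sqrt 2)⁻¹ • (stdb p q 0 + ε • stdb p q (p + q - 1))) i ^ 2 = 1 := by
  have hs : ((Real.sqrt 2)⁻¹) ^ 2 = 1 / 2 := by rw [inv_pow, Real.sq_sqrt (by norm_num)]; norm_num
  have hterm : ∀ i : Fin (p + q),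
      ((Real.sqrt 2)⁻¹ • (stdb p q 0 + ε • stdb p q (p + q - 1))) i ^ 2
        = (if i = ⟨0, by omega⟩ then 1 / 2 else 0)
          + (if i = ⟨p + q - 1, by omega⟩ then 1 / 2 else 0) := by
    intro i
    simp only [Pi.smul_apply, Pi.add_apply, stdb, smul_eq_mul, mul_pow, hs, Fin.ext_iff]
    split_ifs
    · omega
    · ring
    · linear_combination (1 / 2) * hε
    · ring
  simp only [hterm, Finset.sum_add_distrib, Finset.sum_ite_eq', Finset.mem_univ, if_true]
  norm_num

/-- Expansion of the squared Euclidean norm of `r (a x + s v)`. -/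
theorem sum_sq_smul_add (p q : ℕ) (x v : Fin (p + q) → ℝ) (r a s : ℝ) :
    ∑ i, (r • (a • x + s • v)) i ^ 2
      = r ^ 2 * (a ^ 2 * ∑ i, x i ^ 2 + 2 * a * s * bEucl p q x v + s ^ 2 * ∑ i, v i ^ 2) := by
  simp only [bEucl, Finset.mul_sum, ← Finset.sum_add_distrib]
  refine Finset.sum_congr rfl fun i _ => ?_
  simp only [Pi.smul_apply, Pi.add_apply, smul_eq_mul]
  ring

/-- Key estimate: for `ε = ±1`, `v = (e₁ + ε e_n)/√2`, `ε q(x) > 0`,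
`ε t b(x,v) ≥ 0` and `u ∈ [0,1]`, with `c = ut·b(x,v) + t²u²q(x)/4`, one has
`εc ≥ 0`, `D = 1 + tu⟨x,v⟩ + εt²u²q(x)/4 = 1 + εc ≥ 1`, and
`‖D⁻¹(ux + (tu²q(x)/2)v)‖ ≤ u‖x‖`. -/
theorem translation_flow_ball_estimate (p q : ℕ) (hp : 1 ≤ p) (hpq : p ≤ q)
    (hn : 3 ≤ p + q) (ε : ℝ) (hε : ε = 1 ∨ ε = -1)
    (v : Fin (p + q) → ℝ)
    (hv : v = (Real.sqrt 2)⁻¹ • (stdb p q 0 + ε • stdb p q (p + q - 1)))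
    (x : Fin (p + q) → ℝ) (hqx : ε * qpq p q x > 0)
    (t : ℝ) (ht : ε * t * bEucl p q x v ≥ 0)
    (u : ℝ) (hu : u ∈ Set.Icc (0 : ℝ) 1)
    (c D : ℝ)
    (hc : c = u * t * bEucl p q x v + t ^ 2 * u ^ 2 * qpq p q x / 4)
    (hD : D = 1 + t * u * bpq p q x v + ε * t ^ 2 * u ^ 2 * qpq p q x / 4) :
    ε * c ≥ 0 ∧ D = 1 + ε * c ∧ 1 ≤ D ∧
      eNorm p q (D⁻¹ • (u • x + (t * u ^ 2 * qpq p q x / 2) • v))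
        ≤ u * eNorm p q x := by
  have hεε : ε * ε = 1 := by rcases hε with rfl | rfl <;> norm_num
  have hb : bpq p q x v = ε * bEucl p q x v := hv ▸ bpq_eq_mul_bEucl p q hp hpq ε _ hεε x
  have hv1 : ∑ i, v i ^ 2 = 1 := hv ▸ sum_sq_unit_vector p q (by omega) ε hεε
  have hQ : ε * qpq p q x ≤ ∑ i, x i ^ 2 := by
    have h := abs_le.mp (abs_qpq_le p q hpq x)
    rcases hε with rfl | rfl <;> linarith
  obtain ⟨hu0, -⟩ := hu
  have ha : 0 ≤ u * (ε * t * bEucl p q x v) := mul_nonneg hu0 ht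
  have hr : 0 ≤ (t * u) ^ 2 * (ε * qpq p q x) := mul_nonneg (sq_nonneg _) hqx.le
  have hεc : 0 ≤ ε * c := by rw [hc]; linarith
  have hDc : D = 1 + ε * c := by rw [hD, hc, hb]; ring
  have hD1 : 1 ≤ D := by linarith
  refine ⟨hεc, hDc, hD1, ?_⟩
  have hD0 : 0 < D := by linarith
  rw [eNorm, eNorm, sum_sq_smul_add, hv1]
  refine Real.sqrt_le_iff.mpr ⟨by positivity, ?_⟩
  rw [mul_pow, Real.sq_sqrt (Finset.sum_nonneg fun i _ => sq_nonneg _), inv_pow,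
    inv_mul_le_iff₀ (by positivity)]
  set N := ∑ i, x i ^ 2
  have hN : 0 ≤ N := hqx.le.trans hQ
  calc u ^ 2 * N + 2 * u * (t * u ^ 2 * qpq p q x / 2) * bEucl p q x v
          + (t * u ^ 2 * qpq p q x / 2) ^ 2 * 1
      = u ^ 2 * (N + ε * c * (ε * qpq p q x)) := by
        rw [hc]
        linear_combination (-(u ^ 2 * qpq p q x
          * (u * t * bEucl p q x v + t ^ 2 * u ^ 2 * qpq p q x / 4))) * hεε
    _ ≤ u ^ 2 * (N + ε * c * N) := by gcongr
    _ = u ^ 2 * (D * N) := by rw [hDc]; ring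
    _ ≤ u ^ 2 * (D ^ 2 * N) := by
        gcongr
        exact le_self_pow₀ hD1 two_ne_zero
    _ = D ^ 2 * (u ^ 2 * N) := by ring
end

section
/- For n ≥ 4 and a ∈ R, let x ∈ R^n with q(x) ≠ 0, and let α_x(t) = 1 + (x_1 + a x_3) t + (x_2/2 + a² q(x)/4) t² − (x_n/6) t³ − (q(x)/48) t⁴. Then there exists T > 0 such that α_x(t) ≠ 0 for all |t| ≥ T, and each of the following functions tends to 0 both as t → +∞ and as t → −∞: (x_1 + x_2 t − x_n t²/2 − q(x) t³/12)/α_x(t); (x_2 − x_n t − q(x) t²/4)/α_x(t); (x_3 + a q(x) t/2)/α_x(t); x_i/α_x(t) for 4 ≤ i ≤ n−1; (x_n + q(x) t/2)/α_x(t); and q(x)/α_x(t). (This expresses that h^t · j^o(x) → o in Ein^{1,n−1} as t → ±∞, uniformly giving strong stability of the flow on the set q(x) ≠ 0.) -/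
open Filter

/-- The Lorentzian quadratic form `q(x) = 2x₁x_n + x₂² + ⋯ + x_{n−1}²` on
`ℝ^{1,n−1} = ℝ^n`, with `n = m + 4 ≥ 4` (0-indexed coordinates). -/
noncomputable def qL (m : ℕ) (x : Fin (m + 4) → ℝ) : ℝ :=
  2 * x ⟨0, by omega⟩ * x ⟨m + 3, by omega⟩
    + ∑ i : Fin (m + 2), x ⟨1 + i, by omega⟩ ^ 2

/-- The polynomial `α_x(t) = 1 + (x₁ + ax₃)t + (x₂/2 + a²q(x)/4)t² − (x_n/6)t³
− (q(x)/48)t⁴`. -/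
noncomputable def alphaX (m : ℕ) (a : ℝ) (x : Fin (m + 4) → ℝ) (t : ℝ) : ℝ :=
  1 + (x ⟨0, by omega⟩ + a * x ⟨2, by omega⟩) * t
    + (x ⟨1, by omega⟩ / 2 + a ^ 2 * qL m x / 4) * t ^ 2
    - x ⟨m + 3, by omega⟩ / 6 * t ^ 3
    - qL m x / 48 * t ^ 4

/-- In the variable `t⁻¹`, a quartic divided by its top power tends to its leading coefficient. -/
lemma tendsto_quartic_div_pow_cobounded (d₀ d₁ d₂ d₃ d₄ : ℝ) :
    Tendsto (fun t : ℝ => d₀ * t⁻¹ ^ 4 + d₁ * t⁻¹ ^ 3 + d₂ * t⁻¹ ^ 2 + d₃ * t⁻¹ + d₄)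
      (Bornology.cobounded ℝ) (nhds d₄) := by
  have hc : Continuous fun s : ℝ => d₀ * s ^ 4 + d₁ * s ^ 3 + d₂ * s ^ 2 + d₃ * s + d₄ := by
    fun_prop
  simpa [Function.comp_def] using (hc.tendsto 0).comp (tendsto_inv₀_cobounded (α := ℝ))

lemma eventually_quartic_ne_zero (d₀ d₁ d₂ d₃ : ℝ) {d₄ : ℝ} (hd : d₄ ≠ 0) :
    ∀ᶠ t : ℝ in Bornology.cobounded ℝ,
      d₀ + d₁ * t + d₂ * t ^ 2 + d₃ * t ^ 3 + d₄ * t ^ 4 ≠ 0 := by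
  filter_upwards [(tendsto_quartic_div_pow_cobounded d₀ d₁ d₂ d₃ d₄).eventually_ne hd,
    Bornology.eventually_ne_cobounded (0 : ℝ)] with t ht ht0 h
  apply ht
  field_simp
  linear_combination h

lemma tendsto_cubic_div_quartic_cobounded (c₀ c₁ c₂ c₃ d₀ d₁ d₂ d₃ : ℝ) {d₄ : ℝ} (hd : d₄ ≠ 0) :
    Tendsto (fun t : ℝ => (c₀ + c₁ * t + c₂ * t ^ 2 + c₃ * t ^ 3) /
      (d₀ + d₁ * t + d₂ * t ^ 2 + d₃ * t ^ 3 + d₄ * t ^ 4)) (Bornology.cobounded ℝ) (nhds 0) := by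
  have h := (tendsto_quartic_div_pow_cobounded c₀ c₁ c₂ c₃ 0).div
    (tendsto_quartic_div_pow_cobounded d₀ d₁ d₂ d₃ d₄) hd
  rw [zero_div] at h
  refine h.congr' ?_
  filter_upwards [Bornology.eventually_ne_cobounded (0 : ℝ)] with t ht0
  simp only [Pi.div_apply]
  rw [← mul_div_mul_right _ _ (pow_ne_zero 4 ht0)]
  congr 1
  · field_simp
    ring
  · field_simp

lemma exists_forall_le_abs_alphaX_ne_zero (m : ℕ) (a : ℝ) (x : Fin (m + 4) → ℝ)
    (hq : qL m x ≠ 0) : ∃ T > (0 : ℝ), ∀ t : ℝ, T ≤ |t| → alphaX m a x t ≠ 0 := by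
  have hd : -(qL m x / 48) ≠ 0 := by simpa using hq
  obtain ⟨T, -, hT⟩ := (hasBasis_cobounded_norm (E := ℝ)).eventually_iff.mp
    (eventually_quartic_ne_zero 1 (x ⟨0, by omega⟩ + a * x ⟨2, by omega⟩)
      (x ⟨1, by omega⟩ / 2 + a ^ 2 * qL m x / 4) (-(x ⟨m + 3, by omega⟩ / 6)) hd)
  refine ⟨max T 1, by positivity, fun t ht h => hT ((le_max_left T 1).trans ht) ?_⟩
  rw [← h, alphaX]
  ring

lemma tendsto_cubic_div_alphaX {m : ℕ} (a : ℝ) {x : Fin (m + 4) → ℝ} (hq : qL m x ≠ 0)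
    (c₀ c₁ c₂ c₃ : ℝ) {f : ℝ → ℝ} (hf : ∀ t, f t = c₀ + c₁ * t + c₂ * t ^ 2 + c₃ * t ^ 3) :
    Tendsto (fun t => f t / alphaX m a x t) atTop (nhds 0)
      ∧ Tendsto (fun t => f t / alphaX m a x t) atBot (nhds 0) := by
  have hd : -(qL m x / 48) ≠ 0 := by simpa using hq
  have h : Tendsto (fun t => f t / alphaX m a x t) (Bornology.cobounded ℝ) (nhds 0) := by
    refine (tendsto_cubic_div_quartic_cobounded c₀ c₁ c₂ c₃ 1
      (x ⟨0, by omega⟩ + a * x ⟨2, by omega⟩) (x ⟨1, by omega⟩ / 2 + a ^ 2 * qL m x / 4)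
      (-(x ⟨m + 3, by omega⟩ / 6)) hd).congr fun t => ?_
    rw [hf, alphaX]
    congr 1
    ring
  rw [IsOrderBornology.cobounded_eq, tendsto_sup] at h
  exact h.symm

/-- If `q(x) ≠ 0`, then `α_x(t) ≠ 0` for `|t|` large, and every coordinate of
`h^t · j^o(x)` in the chart at infinity tends to `0` as `t → ±∞`
(so `h^t · j^o(x) → o` in `Ein^{1,n−1}`). -/
theorem holonomy_orbit_tends_to_origin (m : ℕ) (a : ℝ) (x : Fin (m + 4) → ℝ)
    (hq : qL m x ≠ 0) :
    (∃ T > (0 : ℝ), ∀ t : ℝ, T ≤ |t| → alphaX m a x t ≠ 0)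
    ∧ (Tendsto (fun t : ℝ =>
          (x ⟨0, by omega⟩ + x ⟨1, by omega⟩ * t - x ⟨m + 3, by omega⟩ * t ^ 2 / 2
            - qL m x * t ^ 3 / 12) / alphaX m a x t) atTop (nhds 0)
        ∧ Tendsto (fun t : ℝ =>
          (x ⟨0, by omega⟩ + x ⟨1, by omega⟩ * t - x ⟨m + 3, by omega⟩ * t ^ 2 / 2
            - qL m x * t ^ 3 / 12) / alphaX m a x t) atBot (nhds 0))
    ∧ (Tendsto (fun t : ℝ =>
          (x ⟨1, by omega⟩ - x ⟨m + 3, by omega⟩ * t - qL m x * t ^ 2 / 4)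
            / alphaX m a x t) atTop (nhds 0)
        ∧ Tendsto (fun t : ℝ =>
          (x ⟨1, by omega⟩ - x ⟨m + 3, by omega⟩ * t - qL m x * t ^ 2 / 4)
            / alphaX m a x t) atBot (nhds 0))
    ∧ (Tendsto (fun t : ℝ =>
          (x ⟨2, by omega⟩ + a * qL m x * t / 2) / alphaX m a x t) atTop (nhds 0)
        ∧ Tendsto (fun t : ℝ =>
          (x ⟨2, by omega⟩ + a * qL m x * t / 2) / alphaX m a x t) atBot (nhds 0))
    ∧ (∀ i : Fin (m + 4), 3 ≤ (i : ℕ) → (i : ℕ) ≤ m + 2 →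
        Tendsto (fun t : ℝ => x i / alphaX m a x t) atTop (nhds 0)
          ∧ Tendsto (fun t : ℝ => x i / alphaX m a x t) atBot (nhds 0))
    ∧ (Tendsto (fun t : ℝ =>
          (x ⟨m + 3, by omega⟩ + qL m x * t / 2) / alphaX m a x t) atTop (nhds 0)
        ∧ Tendsto (fun t : ℝ =>
          (x ⟨m + 3, by omega⟩ + qL m x * t / 2) / alphaX m a x t) atBot (nhds 0))
    ∧ (Tendsto (fun t : ℝ => qL m x / alphaX m a x t) atTop (nhds 0)
        ∧ Tendsto (fun t : ℝ => qL m x / alphaX m a x t) atBot (nhds 0)) := by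
  refine ⟨exists_forall_le_abs_alphaX_ne_zero m a x hq, ?_, ?_, ?_, fun i _ _ => ?_, ?_, ?_⟩
  · exact tendsto_cubic_div_alphaX a hq (x ⟨0, by omega⟩) (x ⟨1, by omega⟩)
      (-(x ⟨m + 3, by omega⟩ / 2)) (-(qL m x / 12)) fun t => by ring
  · exact tendsto_cubic_div_alphaX a hq (x ⟨1, by omega⟩) (-x ⟨m + 3, by omega⟩)
      (-(qL m x / 4)) 0 fun t => by ring
  · exact tendsto_cubic_div_alphaX a hq (x ⟨2, by omega⟩) (a * qL m x / 2) 0 0 fun t => by ring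
  · exact tendsto_cubic_div_alphaX a hq (x i) 0 0 0 fun t => by ring
  · exact tendsto_cubic_div_alphaX a hq (x ⟨m + 3, by omega⟩) (qL m x / 2) 0 0 fun t => by ring
  · exact tendsto_cubic_div_alphaX a hq (qL m x) 0 0 0 fun t => by ring
end
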